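/- Let C be a category that is finitely complete, has coequalizers, and in which regular epimorphisms are closed under composition, let H: C → C be an endofunctor preserving monomorphisms, let ξ: X → HX be a coalgebra, and let q̄: X → K be a morphism such that the kernel pair of q̄ and the kernel pair of H(q̄)∘ξ coincide as subobjects of X × X. Let κ_Q: X ↠ X/Q be the coequalizer of the kernel pair of q̄. Then there is a unique coalgebra structure ζ: X/Q → H(X/Q) making κ_Q a coalgebra morphism (X, ξ) → (X/Q, ζ), i.e. with ζ∘κ_Q = H(κ_Q)∘ξ. -/

import Mathlib

open CategoryTheory CategoryTheory.Limits

universe v u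

/-- If regular epimorphisms are closed under composition, then the comparison morphism from the
coequalizer of the kernel pair of `f` to the codomain of `f` is a monomorphism. -/
theorem mono_desc_coequalizer_kernelPair {C : Type u} [Category.{v} C]
    [HasFiniteLimits C] [HasCoequalizers C]
    (hcomp : ∀ {A B D : C} (f : A ⟶ B) (g : B ⟶ D),
      Nonempty (RegularEpi f) → Nonempty (RegularEpi g) → Nonempty (RegularEpi (f ≫ g)))
    {X K : C} (f : X ⟶ K) :
    Mono (coequalizer.desc (f := pullback.fst f f) (g := pullback.snd f f) f
      pullback.condition) := by
  set κ := coequalizer.π (pullback.fst f f) (pullback.snd f f)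
  set m := coequalizer.desc (f := pullback.fst f f) (g := pullback.snd f f) f pullback.condition
  have hm : κ ≫ m = f := coequalizer.π_desc _ _
  let κ' := coequalizer.π (pullback.fst m m) (pullback.snd m m)
  let n := coequalizer.desc (f := pullback.fst m m) (g := pullback.snd m m) m pullback.condition
  have hn : κ' ≫ n = m := coequalizer.π_desc _ _
  obtain ⟨r⟩ := hcomp κ κ' ⟨coequalizerRegular _ _⟩ ⟨coequalizerRegular _ _⟩
  have hr : r.left ≫ f = r.right ≫ f := by
    simpa only [Category.assoc, hn, hm] using r.w =≫ n
  have hκ : r.left ≫ κ = r.right ≫ κ := by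
    rw [← pullback.lift_fst r.left r.right hr, Category.assoc, coequalizer.condition,
      ← Category.assoc, pullback.lift_snd]
  obtain ⟨w, hw⟩ := Cofork.IsColimit.desc' r.isColimit κ hκ
  have hw' : κ' ≫ w = 𝟙 _ := by
    rw [← cancel_epi κ, Category.comp_id, ← Category.assoc]
    exact hw
  have hp : pullback.fst m m = pullback.snd m m := by
    rw [← Category.comp_id (pullback.fst m m), ← hw', ← Category.assoc, coequalizer.condition,
      Category.assoc, hw', Category.comp_id]
  refine ⟨fun g h hgh => ?_⟩
  rw [← pullback.lift_fst g h hgh, hp, pullback.lift_snd]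

/-- **Induced coalgebra structure on the quotient.**
Let `C` be finitely complete with coequalizers, in which regular epimorphisms are closed
under composition, let `H : C ⥤ C` preserve monomorphisms, and let `ξ : X ⟶ HX` be a
coalgebra.  Let `qbar : X ⟶ K` be a morphism such that the kernel pair of `qbar` is also a
kernel pair of `H qbar ∘ ξ` (i.e. the two kernel pairs coincide as subobjects of `X × X`).
Let `κ_Q : X ↠ X/Q` be the coequalizer of the kernel pair of `qbar`.  Then there is a
unique coalgebra structure `ζ : X/Q ⟶ H(X/Q)` making `κ_Q` a coalgebra morphism
`(X, ξ) → (X/Q, ζ)`, i.e. with `ζ ∘ κ_Q = H κ_Q ∘ ξ`. -/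
theorem quotient_coalgebra_structure {C : Type u} [Category.{v} C]
    [HasFiniteLimits C] [HasCoequalizers C]
    (hcomp : ∀ {A B D : C} (f : A ⟶ B) (g : B ⟶ D),
      Nonempty (RegularEpi f) → Nonempty (RegularEpi g) → Nonempty (RegularEpi (f ≫ g)))
    (H : C ⥤ C) [H.PreservesMonomorphisms]
    (X : C) (ξ : X ⟶ H.obj X) (K : C) (qbar : X ⟶ K)
    (hker : IsKernelPair (ξ ≫ H.map qbar) (pullback.fst qbar qbar) (pullback.snd qbar qbar)) :
    ∃! ζ : coequalizer (pullback.fst qbar qbar) (pullback.snd qbar qbar) ⟶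
            H.obj (coequalizer (pullback.fst qbar qbar) (pullback.snd qbar qbar)),
      coequalizer.π _ _ ≫ ζ = ξ ≫ H.map (coequalizer.π _ _) := by
  have := mono_desc_coequalizer_kernelPair hcomp qbar
  have hκ : pullback.fst qbar qbar ≫
        ξ ≫ H.map (coequalizer.π (pullback.fst qbar qbar) (pullback.snd qbar qbar)) =
      pullback.snd qbar qbar ≫
        ξ ≫ H.map (coequalizer.π (pullback.fst qbar qbar) (pullback.snd qbar qbar)) := by
    rw [← cancel_mono (H.map (coequalizer.desc (f := pullback.fst qbar qbar)
      (g := pullback.snd qbar qbar) qbar pullback.condition))]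
    simpa only [Category.assoc, ← H.map_comp, coequalizer.π_desc] using hker.w
  refine ⟨coequalizer.desc _ hκ, coequalizer.π_desc _ _, fun ζ hζ => ?_⟩
  rw [← cancel_epi (coequalizer.π (pullback.fst qbar qbar) (pullback.snd qbar qbar)), hζ,
    coequalizer.π_desc]
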